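/- arXiv:2401.08800 — 2 statements merged into one kernel-verified Lean document; each statement's English description precedes it below -/
import Mathlib

section
/- For a 10-element clique S in C with weights in {1,3}, let n(S) denote the number of unordered pairs {x,y} contained in S with B(x,y) = 3. Then n(S) lies in {2,3,4,5} for every such clique; the cliques with n(S) = 2 form a single W-orbit, the cliques with n(S) = 3 form exactly two W-orbits, the cliques with n(S) = 4 form exactly two W-orbits, and the cliques with n(S) = 5 form a single W-orbit. -/
/-- The intersection pairing on `ℤ⁹`, the Picard lattice of a del Pezzo surface of degree 1. -/
def B (v w : Fin 9 → ℤ) : ℤ := v 0 * w 0 - ∑ i : Fin 8, v i.succ * w i.succ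

/-- The canonical class `K = (-3, -1, …, -1)`. -/
def Kcl : Fin 9 → ℤ := fun i => if i = 0 then -3 else -1

/-- A vector is an exceptional class if `B(v,v) = -1` and `B(v,K) = -1`. -/
def IsExc (v : Fin 9 → ℤ) : Prop := B v v = -1 ∧ B v Kcl = -1

/-- The type of exceptional classes (the set `C`). -/
abbrev Exc : Type := {v : Fin 9 → ℤ // IsExc v}

/-- The pairing on exceptional classes. -/
def Bx (x y : Exc) : ℤ := B x.1 y.1

/-- `S` is a clique with weights in `M` if `B(x,y) ∈ M` for all distinct `x, y ∈ S`. -/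
def IsClique (M : Set ℤ) (S : Finset Exc) : Prop :=
  ∀ x ∈ S, ∀ y ∈ S, x ≠ y → Bx x y ∈ M

/-- A bijection of `C` preserving the pairing `B`: an element of the Weyl group `W`. -/
def PreservesB (g : Exc ≃ Exc) : Prop := ∀ x y : Exc, Bx (g x) (g y) = Bx x y

/-- Two finite subsets of `C` lie in the same orbit of `W`. -/
def SameOrbit (S T : Finset Exc) : Prop :=
  ∃ g : Exc ≃ Exc, PreservesB g ∧ S.image g = T

/-- The number of unordered pairs `{x,y} ⊆ S` with `B(x,y) = 3`. -/
def nPairs3 (S : Finset Exc) : ℕ :=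
  ((S.powersetCard 2).filter (fun P => ∀ x ∈ P, ∀ y ∈ P, x ≠ y → Bx x y = 3)).card

/-- A 10-element clique with weights in `{1,3}`. -/
def Clique13 (S : Finset Exc) : Prop := S.card = 10 ∧ IsClique {1, 3} S

instance : DecidablePred IsExc := fun v => by unfold IsExc; infer_instance

/-- Inner product of the roots `x + K`, `y + K` (positive definite). -/
def pp (x y : Exc) : ℤ := 1 - Bx x y

theorem B_comm (v w : Fin 9 → ℤ) : B v w = B w v := by
  simp only [B, mul_comm]

theorem B_add (u v w : Fin 9 → ℤ) (c : ℤ) :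
    B (fun i => u i - c * (v i + Kcl i)) w = B u w - c * (B v w + B Kcl w) := by
  simp only [B, Fin.sum_univ_eight]; ring

theorem B_KK : B Kcl Kcl = 1 := by decide

theorem Bx_eq (x y : Exc) : B x.1 y.1 = 1 - pp x y := by simp [pp, Bx]

theorem B_self (x : Exc) : B x.1 x.1 = -1 := x.2.1
theorem B_K (x : Exc) : B x.1 Kcl = -1 := x.2.2
theorem B_K' (x : Exc) : B Kcl x.1 = -1 := by rw [B_comm]; exact x.2.2

theorem pp_comm (x y : Exc) : pp x y = pp y x := by simp only [pp, Bx, B_comm]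

theorem pp_self (x : Exc) : pp x x = 2 := by
  simp [pp, Bx, B_self]

/-- Reflection in the root `h + K`, as a map on vectors. -/
def rv (h x : Exc) : Fin 9 → ℤ := fun i => x.1 i - pp x h * (h.1 i + Kcl i)

theorem B_rv (h x : Exc) (w : Fin 9 → ℤ) :
    B (rv h x) w = B x.1 w - pp x h * (B h.1 w + B Kcl w) := B_add _ _ _ _

theorem rv_exc (h x : Exc) : IsExc (rv h x) := by
  constructor
  · rw [B_rv, B_comm x.1, B_comm h.1, B_comm Kcl, B_rv, B_rv, B_rv]
    simp only [B_self, B_K, B_K', B_KK, Bx_eq, pp_comm h x]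
    ring
  · rw [B_rv, B_K, B_K, B_KK]; ring

def rfx (h x : Exc) : Exc := ⟨rv h x, rv_exc h x⟩

theorem pp_refl (h x y : Exc) : pp (rfx h x) y = pp x y - pp x h * pp h y := by
  have : B (rfx h x).1 y.1 = _ := B_rv h x y.1
  rw [Bx_eq, Bx_eq, Bx_eq, B_K'] at this
  linarith

theorem refl_refl (h x : Exc) : rfx h (rfx h x) = x := by
  apply Subtype.ext
  funext i
  change rv h x i - pp (rfx h x) h * (h.1 i + Kcl i) = x.1 i
  rw [pp_refl, pp_self, rv]; ring

theorem pp_refl_refl (h x y : Exc) : pp (rfx h x) (rfx h y) = pp x y := by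
  rw [pp_refl, pp_comm x, pp_comm h (rfx h y), pp_refl, pp_refl, pp_self, pp_comm y x,
    pp_comm y h, pp_comm x h]; ring

def reflE (h : Exc) : Exc ≃ Exc := ⟨rfx h, rfx h, refl_refl h, refl_refl h⟩

@[simp] theorem reflE_apply (h x : Exc) : reflE h x = rfx h x := rfl

theorem pres_iff (g : Exc ≃ Exc) : PreservesB g ↔ ∀ x y, pp (g x) (g y) = pp x y := by
  simp [PreservesB, pp]

theorem pres_reflE (h : Exc) : PreservesB (reflE h) :=
  (pres_iff _).2 (pp_refl_refl h)

theorem pres_refl : PreservesB (Equiv.refl Exc) := fun _ _ => rfl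

theorem pres_trans {f g : Exc ≃ Exc} (hf : PreservesB f) (hg : PreservesB g) :
    PreservesB (f.trans g) := fun x y => by
  simp only [Equiv.trans_apply]; rw [hg, hf]

theorem pres_symm {f : Exc ≃ Exc} (hf : PreservesB f) : PreservesB f.symm := fun x y => by
  rw [← hf]; simp

theorem refl_fix (h x : Exc) (e : pp x h = 0) : rfx h x = x := by
  apply Subtype.ext
  funext i
  change x.1 i - pp x h * (h.1 i + Kcl i) = x.1 i
  rw [e]; ring

/-- The antipode. -/
def ng (x : Exc) : Exc := rfx x x

theorem pp_ng (x y : Exc) : pp (ng x) y = - pp x y := by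
  rw [ng, pp_refl, pp_self]; ring

theorem ng_ng (x : Exc) : ng (ng x) = x := by
  apply Subtype.ext
  funext i
  change rv x x i - pp (ng x) (ng x) * (rv x x i + Kcl i) = x.1 i
  rw [pp_self, rv, pp_self]; ring

/-! The standard frame. -/

def rvec : Fin 8 → Fin 9 → ℤ := ![
  ![3, 2, 1, 1, 1, 1, 1, 1, 0],
  ![3, 1, 2, 1, 1, 1, 1, 0, 1],
  ![3, 1, 1, 2, 1, 1, 0, 1, 1],
  ![5, 2, 2, 2, 1, 1, 2, 2, 2],
  ![3, 1, 1, 1, 2, 0, 1, 1, 1],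
  ![5, 2, 2, 1, 2, 2, 1, 2, 2],
  ![5, 2, 1, 2, 2, 2, 2, 1, 2],
  ![5, 1, 2, 2, 2, 2, 2, 2, 1]]

theorem rvec_exc : ∀ i, IsExc (rvec i) := by decide +kernel

def r (i : Fin 8) : Exc := ⟨rvec i, rvec_exc i⟩

theorem K_lin (x : Exc) : 3 * x.1 0 = x.1 1 + x.1 2 + x.1 3 + x.1 4 + x.1 5 + x.1 6 + x.1 7
    + x.1 8 + 1 := by
  have := B_K x
  simp [B, Kcl, Fin.sum_univ_eight] at this
  linarith

theorem pp_lin (x y : Exc) : pp x y = 1 - (x.1 0 * y.1 0 - (x.1 1 * y.1 1 + x.1 2 * y.1 2 +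
    x.1 3 * y.1 3 + x.1 4 * y.1 4 + x.1 5 * y.1 5 + x.1 6 * y.1 6 + x.1 7 * y.1 7 +
    x.1 8 * y.1 8)) := by
  simp [pp, Bx, B, Fin.sum_univ_eight]

theorem y0 (x : Exc) : pp x (r 0) = x.1 1 - x.1 8 := by
  have := K_lin x
  rw [pp_lin]; simp [r, rvec]; linarith
theorem y1 (x : Exc) : pp x (r 1) = x.1 2 - x.1 7 := by
  have := K_lin x
  rw [pp_lin]; simp [r, rvec]; linarith
theorem y2 (x : Exc) : pp x (r 2) = x.1 3 - x.1 6 := by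
  have := K_lin x
  rw [pp_lin]; simp [r, rvec]; linarith
theorem y4 (x : Exc) : pp x (r 4) = x.1 4 - x.1 5 := by
  have := K_lin x
  rw [pp_lin]; simp [r, rvec]; linarith
theorem y3 (x : Exc) : pp x (r 3) = x.1 0 - x.1 4 - x.1 5 - 1 := by
  have := K_lin x
  rw [pp_lin]; simp [r, rvec]; linarith
theorem y5 (x : Exc) : pp x (r 5) = x.1 0 - x.1 3 - x.1 6 - 1 := by
  have := K_lin x
  rw [pp_lin]; simp [r, rvec]; linarith
theorem y6 (x : Exc) : pp x (r 6) = x.1 0 - x.1 2 - x.1 7 - 1 := by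
  have := K_lin x
  rw [pp_lin]; simp [r, rvec]; linarith
theorem y7 (x : Exc) : pp x (r 7) = x.1 0 - x.1 1 - x.1 8 - 1 := by
  have := K_lin x
  rw [pp_lin]; simp [r, rvec]; linarith

theorem pp_sum (x z : Exc) : 2 * pp x z = ∑ i, pp x (r i) * pp z (r i) := by
  have hx := K_lin x
  have hz := K_lin z
  rw [Fin.sum_univ_eight, y0, y1, y2, y3, y4, y5, y6, y7, y0, y1, y2, y3, y4, y5, y6, y7, pp_lin]
  have hx' : x.1 8 = 3 * x.1 0 - x.1 1 - x.1 2 - x.1 3 - x.1 4 - x.1 5 - x.1 6 - x.1 7 - 1 := by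
    linarith
  have hz' : z.1 8 = 3 * z.1 0 - z.1 1 - z.1 2 - z.1 3 - z.1 4 - z.1 5 - z.1 6 - z.1 7 - 1 := by
    linarith
  rw [hx', hz']; ring

theorem inj (x z : Exc) (h : ∀ i, pp x (r i) = pp z (r i)) : x = z := by
  have hx := K_lin x
  have hz := K_lin z
  have h0 := h 0
  have h1 := h 1
  have h2 := h 2
  have h3 := h 3
  have h4 := h 4
  have h5 := h 5
  have h6 := h 6
  have h7 := h 7
  rw [y0, y0] at h0
  rw [y1, y1] at h1
  rw [y2, y2] at h2
  rw [y3, y3] at h3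
  rw [y4, y4] at h4
  rw [y5, y5] at h5
  rw [y6, y6] at h6
  rw [y7, y7] at h7
  apply Subtype.ext
  funext i
  fin_cases i <;> simp <;> omega

theorem sq_sum (x : Exc) : ∑ i, pp x (r i) ^ 2 = 4 := by
  have := pp_sum x x
  rw [pp_self] at this
  simp only [pow_two]; omega

theorem eq_of_pp (x z : Exc) (h : pp x z = 2) : x = z := by
  apply inj
  have e : ∑ i, (pp x (r i) - pp z (r i)) ^ 2 = 0 := by
    have h1 := sq_sum x
    have h2 := sq_sum z
    have h3 := pp_sum x z
    have : ∑ i, (pp x (r i) - pp z (r i)) ^ 2 = ∑ i, pp x (r i) ^ 2 + ∑ i, pp z (r i) ^ 2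
        - 2 * ∑ i, pp x (r i) * pp z (r i) := by
      rw [Finset.mul_sum, ← Finset.sum_add_distrib, ← Finset.sum_sub_distrib]
      exact Finset.sum_congr rfl fun i _ => by ring
    rw [this, ← h3, h1, h2, h]; norm_num
  rw [Finset.sum_eq_zero_iff_of_nonneg (fun i _ => sq_nonneg _)] at e
  intro i
  have := e i (Finset.mem_univ i)
  have := pow_eq_zero_iff (two_ne_zero) |>.1 this
  linarith

theorem pp_le (x z : Exc) : pp x z ≤ 2 := by
  have e : 0 ≤ ∑ i, (pp x (r i) - pp z (r i)) ^ 2 := Finset.sum_nonneg fun i _ => sq_nonneg _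
  have h1 := sq_sum x
  have h2 := sq_sum z
  have h3 := pp_sum x z
  have : ∑ i, (pp x (r i) - pp z (r i)) ^ 2 = ∑ i, pp x (r i) ^ 2 + ∑ i, pp z (r i) ^ 2
      - 2 * ∑ i, pp x (r i) * pp z (r i) := by
    rw [Finset.mul_sum, ← Finset.sum_add_distrib, ← Finset.sum_sub_distrib]
    exact Finset.sum_congr rfl fun i _ => by ring
  linarith

theorem le_pp (x z : Exc) : -2 ≤ pp x z := by
  have := pp_le (ng x) z
  rw [pp_ng] at this; linarith

theorem eq_ng (x z : Exc) (h : pp x z = -2) : x = ng z := by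
  rw [← ng_ng x]
  congr 1
  apply eq_of_pp
  rw [pp_ng, h]; rfl

theorem mv1 (x s : Exc) (h : pp x s ≠ 0) : ∃ g : Exc ≃ Exc, PreservesB g ∧ g x = s ∧
    ∀ z, pp z x = 0 → pp z s = 0 → g z = z := by
  have h1 := pp_le x s
  have h2 := le_pp x s
  have : pp x s = -2 ∨ pp x s = -1 ∨ pp x s = 1 ∨ pp x s = 2 := by omega
  rcases this with e | e | e | e
  · refine ⟨reflE s, pres_reflE s, ?_, fun z _ hs => refl_fix _ _ hs⟩
    apply eq_of_pp
    rw [reflE_apply, pp_refl, e, pp_self]; rfl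
  · refine ⟨(reflE s).trans (reflE x), pres_trans (pres_reflE s) (pres_reflE x), ?_, ?_⟩
    · apply eq_of_pp
      simp only [Equiv.trans_apply, reflE_apply, pp_refl, pp_self, e, pp_comm s x]; rfl
    · intro z hx hs
      simp only [Equiv.trans_apply, reflE_apply, refl_fix _ _ hs, refl_fix _ _ hx]
  · refine ⟨((reflE s).trans (reflE x)).trans (reflE s),
      pres_trans (pres_trans (pres_reflE s) (pres_reflE x)) (pres_reflE s), ?_, ?_⟩
    · apply eq_of_pp
      simp only [Equiv.trans_apply, reflE_apply, pp_refl, pp_self, e, pp_comm s x]; rfl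
    · intro z hx hs
      simp only [Equiv.trans_apply, reflE_apply, refl_fix _ _ hs, refl_fix _ _ hx]
  · exact ⟨Equiv.refl _, pres_refl, eq_of_pp _ _ e, fun _ _ _ => rfl⟩

theorem mv2 (x h s : Exc) (h1 : pp x h ≠ 0) (h2 : pp h s ≠ 0) :
    ∃ g : Exc ≃ Exc, PreservesB g ∧ g x = s ∧
    ∀ z, pp z x = 0 → pp z h = 0 → pp z s = 0 → g z = z := by
  obtain ⟨g, hg, gx, gf⟩ := mv1 x h h1
  obtain ⟨k, hk, kx, kf⟩ := mv1 h s h2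
  refine ⟨g.trans k, pres_trans hg hk, by simp [gx, kx], fun z a b c => ?_⟩
  simp [gf z a b, kf z b c]

/-- Transitivity step. -/
theorem step (n : ℕ) (H : Fin n → Exc) (F : Finset (Fin 8)) (s : Fin 8) (hs : s ∉ F)
    (h1 : ∀ k, pp (H k) (r s) ≠ 0) (h2 : ∀ k, ∀ i ∈ F, pp (r i) (H k) = 0)
    (hr : ∀ i j, i ≠ j → pp (r i) (r j) = 0)
    (x : Exc) (hx : ∀ i ∈ F, pp (r i) x = 0) (hex : ∃ k, pp x (H k) ≠ 0) :
    ∃ g : Exc ≃ Exc, PreservesB g ∧ g x = r s ∧ ∀ i ∈ F, g (r i) = r i := by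
  obtain ⟨k, hk⟩ := hex
  obtain ⟨g, hg, gx, gf⟩ := mv2 x (H k) (r s) hk (h1 k)
  refine ⟨g, hg, gx, fun i hi => gf _ (hx i hi) (h2 k i hi) (hr i s ?_)⟩
  rintro rfl; exact hs hi

theorem r_orth : ∀ i j, i ≠ j → pp (r i) (r j) = 0 := by decide +kernel

theorem not_all_zero (x : Exc) (h : ∀ i, pp x (r i) = 0) : False := by
  have := sq_sum x
  simp [h] at this

def H0v : Fin 8 → Fin 9 → ℤ := ![
 ![3, 2, 1, 1, 1, 1, 1, 1, 0],
 ![3, 2, 1, 1, 1, 1, 1, 0, 1],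
 ![3, 2, 1, 1, 1, 1, 0, 1, 1],
 ![3, 2, 1, 1, 1, 0, 1, 1, 1],
 ![3, 2, 1, 1, 0, 1, 1, 1, 1],
 ![3, 2, 1, 0, 1, 1, 1, 1, 1],
 ![3, 2, 0, 1, 1, 1, 1, 1, 1],
 ![4, 2, 2, 2, 1, 1, 1, 1, 1]]
theorem H0e : ∀ i, IsExc (H0v i) := by decide +kernel
def H0 (i : Fin 8) : Exc := ⟨H0v i, H0e i⟩

def H1v : Fin 7 → Fin 9 → ℤ := ![
 ![3, 1, 2, 1, 1, 1, 1, 0, 1],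
 ![3, 1, 2, 1, 1, 1, 0, 1, 1],
 ![3, 1, 2, 1, 1, 0, 1, 1, 1],
 ![3, 1, 2, 1, 0, 1, 1, 1, 1],
 ![3, 1, 2, 0, 1, 1, 1, 1, 1],
 ![4, 2, 2, 1, 1, 1, 1, 1, 2],
 ![4, 1, 2, 2, 2, 1, 1, 1, 1]]
theorem H1e : ∀ i, IsExc (H1v i) := by decide +kernel
def H1 (i : Fin 7) : Exc := ⟨H1v i, H1e i⟩

def H2v : Fin 6 → Fin 9 → ℤ := ![
 ![3, 1, 1, 2, 1, 1, 0, 1, 1],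
 ![3, 1, 1, 2, 1, 0, 1, 1, 1],
 ![3, 1, 1, 2, 0, 1, 1, 1, 1],
 ![4, 2, 1, 2, 1, 1, 1, 1, 2],
 ![4, 1, 2, 2, 1, 1, 1, 2, 1],
 ![4, 1, 1, 2, 2, 2, 1, 1, 1]]
theorem H2e : ∀ i, IsExc (H2v i) := by decide +kernel
def H2 (i : Fin 6) : Exc := ⟨H2v i, H2e i⟩

def H3v : Fin 4 → Fin 9 → ℤ := ![
 ![3, 1, 1, 1, 2, 0, 1, 1, 1],
 ![4, 2, 1, 1, 2, 1, 1, 1, 2],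
 ![4, 1, 2, 1, 2, 1, 1, 2, 1],
 ![4, 1, 1, 2, 2, 1, 2, 1, 1]]
theorem H3e : ∀ i, IsExc (H3v i) := by decide +kernel
def H3 (i : Fin 4) : Exc := ⟨H3v i, H3e i⟩

theorem step0 (x : Exc) : ∃ g : Exc ≃ Exc, PreservesB g ∧ g x = r 0 := by
  obtain ⟨g, h1, h2, -⟩ := step 8 H0 ∅ 0 (by decide) (by decide +kernel) (by decide +kernel)
    r_orth x (by simp) (by
      by_contra! hc
      have hx := K_lin x
      simp only [Fin.forall_fin_succ, pp_lin] at hc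
      simp [H0, H0v] at hc
      apply not_all_zero x
      intro i
      fin_cases i <;> simp only [Fin.zero_eta, Fin.mk_one, Fin.reduceFinMk, y0, y1, y2, y3, y4, y5, y6, y7] <;> omega)
  exact ⟨g, h1, h2⟩

theorem step1 (x : Exc) (a0 : pp x (r 0) = 0) :
    ∃ g : Exc ≃ Exc, PreservesB g ∧ g x = r 1 ∧ g (r 0) = r 0 := by
  obtain ⟨g, h1, h2, h3⟩ := step 7 H1 {0} 1 (by decide) (by decide +kernel) (by decide +kernel)
    r_orth x (by simp [pp_comm _ x, a0]) (by
      by_contra! hc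
      have hx := K_lin x
      simp only [Fin.forall_fin_succ, pp_lin] at hc
      simp [H1, H1v] at hc
      rw [y0] at a0
      apply not_all_zero x
      intro i
      fin_cases i <;> simp only [Fin.zero_eta, Fin.mk_one, Fin.reduceFinMk, y0, y1, y2, y3, y4, y5, y6, y7] <;> omega)
  exact ⟨g, h1, h2, h3 0 (by simp)⟩

theorem step2 (x : Exc) (a0 : pp x (r 0) = 0) (a1 : pp x (r 1) = 0) :
    ∃ g : Exc ≃ Exc, PreservesB g ∧ g x = r 2 ∧ g (r 0) = r 0 ∧ g (r 1) = r 1 := by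
  obtain ⟨g, h1, h2, h3⟩ := step 6 H2 {0, 1} 2 (by decide) (by decide +kernel) (by decide +kernel)
    r_orth x (by simp [pp_comm _ x, a0, a1]) (by
      by_contra! hc
      have hx := K_lin x
      simp only [Fin.forall_fin_succ, pp_lin] at hc
      simp [H2, H2v] at hc
      rw [y0] at a0
      rw [y1] at a1
      apply not_all_zero x
      intro i
      fin_cases i <;> simp only [Fin.zero_eta, Fin.mk_one, Fin.reduceFinMk, y0, y1, y2, y3, y4, y5, y6, y7] <;> omega)
  exact ⟨g, h1, h2, h3 0 (by simp), h3 1 (by simp)⟩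

theorem step3 (x : Exc) (a0 : pp x (r 0) = 0) (a1 : pp x (r 1) = 0) (a2 : pp x (r 2) = 0)
    (n1 : x ≠ r 3) (n2 : x ≠ ng (r 3)) :
    ∃ g : Exc ≃ Exc, PreservesB g ∧ g x = r 4 ∧ g (r 0) = r 0 ∧ g (r 1) = r 1
      ∧ g (r 2) = r 2 := by
  have a3 : pp x (r 3) = 0 := by
    have k1 := pp_le x (r 3)
    have k2 := le_pp x (r 3)
    have k3 : pp x (r 3) ≠ 2 := fun h => n1 (eq_of_pp _ _ h)
    have k4 : pp x (r 3) ≠ -2 := fun h => n2 (eq_ng _ _ h)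
    have hx := K_lin x
    rw [y3] at *
    rw [y0] at a0
    rw [y1] at a1
    rw [y2] at a2
    omega
  obtain ⟨g, h1, h2, h3⟩ := step 4 H3 {0, 1, 2, 3} 4 (by decide) (by decide +kernel)
    (by decide +kernel) r_orth x (by simp [pp_comm _ x, a0, a1, a2, a3]) (by
      by_contra! hc
      have hx := K_lin x
      simp only [Fin.forall_fin_succ, pp_lin] at hc
      simp [H3, H3v] at hc
      rw [y0] at a0
      rw [y1] at a1
      rw [y2] at a2
      rw [y3] at a3
      apply not_all_zero x
      intro i
      fin_cases i <;> simp only [Fin.zero_eta, Fin.mk_one, Fin.reduceFinMk, y0, y1, y2, y3, y4, y5, y6, y7] <;> omega)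
  exact ⟨g, h1, h2, h3 0 (by simp), h3 1 (by simp), h3 2 (by simp)⟩

/-- The sixteen frame elements. -/
def R (q : Fin 8 × Bool) : Exc := if q.2 then ng (r q.1) else r q.1

theorem in_frame (x : Exc) (a0 : pp x (r 0) = 0) (a1 : pp x (r 1) = 0) (a2 : pp x (r 2) = 0)
    (a4 : pp x (r 4) = 0) : ∃ q, R q = x := by
  by_contra! hc
  have k1 : ∀ i, pp x (r i) ≠ 2 := fun i h => hc (i, false) (eq_of_pp _ _ h).symm
  have k2 : ∀ i, pp x (r i) ≠ -2 := fun i h => hc (i, true) (eq_ng _ _ h).symm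
  have k3 := fun i => pp_le x (r i)
  have k4 := fun i => le_pp x (r i)
  have hx := K_lin x
  have p3 : pp x (r 3) = 0 := by
    have := k1 3; have := k2 3; have := k3 3; have := k4 3
    simp only [y0, y1, y2, y3, y4] at *; omega
  have p5 : pp x (r 5) = 0 := by
    have := k1 5; have := k2 5; have := k3 5; have := k4 5
    simp only [y0, y1, y2, y5, y4] at *; omega
  have p6 : pp x (r 6) = 0 := by
    have := k1 6; have := k2 6; have := k3 6; have := k4 6
    simp only [y0, y1, y2, y6, y4] at *; omega
  have p7 : pp x (r 7) = 0 := by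
    have := k1 7; have := k2 7; have := k3 7; have := k4 7
    simp only [y0, y1, y2, y7, y4] at *; omega
  apply not_all_zero x
  intro i
  fin_cases i
  exacts [a0, a1, a2, p3, a4, p5, p6, p7]

theorem so_refl (S : Finset Exc) : SameOrbit S S := ⟨Equiv.refl _, pres_refl, by simp⟩

theorem so_symm {S T : Finset Exc} (h : SameOrbit S T) : SameOrbit T S := by
  obtain ⟨g, hg, rfl⟩ := h
  refine ⟨g.symm, pres_symm hg, ?_⟩
  rw [Finset.image_image]; simp

theorem so_trans {S T U : Finset Exc} (h : SameOrbit S T) (h' : SameOrbit T U) :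
    SameOrbit S U := by
  obtain ⟨g, hg, rfl⟩ := h
  obtain ⟨k, hk, rfl⟩ := h'
  exact ⟨g.trans k, pres_trans hg hk, by rw [Finset.image_image]; rfl⟩

theorem clique_so {S T : Finset Exc} (h : SameOrbit S T) (hS : Clique13 S) : Clique13 T := by
  obtain ⟨g, hg, rfl⟩ := h
  refine ⟨by rw [Finset.card_image_of_injective _ g.injective, hS.1], ?_⟩
  intro x hx y hy hxy
  simp only [Finset.mem_image] at hx hy
  obtain ⟨a, ha, rfl⟩ := hx
  obtain ⟨b, hb, rfl⟩ := hy
  rw [hg]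
  exact hS.2 a ha b hb (fun e => hxy (by rw [e]))

theorem nP_so {S T : Finset Exc} (h : SameOrbit S T) : nPairs3 S = nPairs3 T := by
  obtain ⟨g, hg, rfl⟩ := h
  unfold nPairs3
  refine Finset.card_bij (fun P _ => P.image g) ?_ ?_ ?_
  · intro P hP
    simp only [Finset.mem_filter, Finset.mem_powersetCard] at hP ⊢
    refine ⟨⟨Finset.image_subset_image hP.1.1, ?_⟩, ?_⟩
    · rw [Finset.card_image_of_injective _ g.injective, hP.1.2]
    · intro x hx y hy hxy
      simp only [Finset.mem_image] at hx hy
      obtain ⟨a, ha, rfl⟩ := hx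
      obtain ⟨b, hb, rfl⟩ := hy
      rw [hg]
      exact hP.2 a ha b hb (fun e => hxy (by rw [e]))
  · intro P _ Q _ e
    exact Finset.image_injective g.injective e
  · intro Q hQ
    simp only [Finset.mem_filter, Finset.mem_powersetCard] at hQ
    refine ⟨Q.image g.symm, ?_, by rw [Finset.image_image]; simp⟩
    simp only [Finset.mem_filter, Finset.mem_powersetCard]
    refine ⟨⟨?_, ?_⟩, ?_⟩
    · intro x hx
      simp only [Finset.mem_image] at hx
      obtain ⟨a, ha, rfl⟩ := hx
      obtain ⟨b, hb, rfl⟩ := Finset.mem_image.1 (hQ.1.1 ha)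
      simpa using hb
    · rw [Finset.card_image_of_injective _ g.symm.injective, hQ.1.2]
    · intro x hx y hy hxy
      simp only [Finset.mem_image] at hx hy
      obtain ⟨a, ha, rfl⟩ := hx
      obtain ⟨b, hb, rfl⟩ := hy
      rw [pres_symm hg]
      exact hQ.2 a ha b hb (fun e => hxy (by rw [e]))

theorem cl_pp {S : Finset Exc} (hS : Clique13 S) {x y : Exc} (hx : x ∈ S) (hy : y ∈ S)
    (h1 : x ≠ y) (h2 : x ≠ ng y) : pp x y = 0 := by
  have := hS.2 x hx y hy h1
  simp only [Set.mem_insert_iff, Set.mem_singleton_iff] at this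
  rcases this with e | e
  · rw [pp, e]; rfl
  · exact absurd (eq_ng x y (by rw [pp, e]; rfl)) h2

theorem pick {S : Finset Exc} (hS : Clique13 S) (F : Finset Exc) (hF : F.card ≤ 9) :
    ∃ x ∈ S, x ∉ F := by
  by_contra! hc
  have := Finset.card_le_card (show S ⊆ F from hc)
  have := hS.1
  omega

theorem norm0 (S : Finset Exc) (hS : Clique13 S) :
    ∃ T, SameOrbit S T ∧ Clique13 T ∧ r 0 ∈ T := by
  obtain ⟨x, hx, -⟩ := pick hS ∅ (by simp)
  obtain ⟨g, hg, gx⟩ := step0 x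
  have so : SameOrbit S (S.image g) := ⟨g, hg, rfl⟩
  exact ⟨_, so, clique_so so hS, gx ▸ Finset.mem_image_of_mem g hx⟩

theorem norm1 (S : Finset Exc) (hS : Clique13 S) :
    ∃ T, SameOrbit S T ∧ Clique13 T ∧ r 0 ∈ T ∧ r 1 ∈ T := by
  obtain ⟨T, so, hT, t0⟩ := norm0 S hS
  obtain ⟨x, hx, hn⟩ := pick hT {r 0, ng (r 0)} (Finset.card_le_two.trans (by norm_num))
  simp only [Finset.mem_insert, Finset.mem_singleton, not_or] at hn
  obtain ⟨g, hg, gx, g0⟩ := step1 x (cl_pp hT hx t0 hn.1 hn.2)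
  have so' : SameOrbit T (T.image g) := ⟨g, hg, rfl⟩
  refine ⟨_, so_trans so so', clique_so so' hT, ?_, gx ▸ Finset.mem_image_of_mem g hx⟩
  have := Finset.mem_image_of_mem g t0
  rwa [g0] at this

theorem norm2 (S : Finset Exc) (hS : Clique13 S) :
    ∃ T, SameOrbit S T ∧ Clique13 T ∧ r 0 ∈ T ∧ r 1 ∈ T ∧ r 2 ∈ T := by
  obtain ⟨T, so, hT, t0, t1⟩ := norm1 S hS
  obtain ⟨x, hx, hn⟩ := pick hT {r 0, ng (r 0), r 1, ng (r 1)}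
    (Finset.card_le_four.trans (by norm_num))
  simp only [Finset.mem_insert, Finset.mem_singleton, not_or] at hn
  obtain ⟨n1, n2, n3, n4⟩ := hn
  obtain ⟨g, hg, gx, g0, g1⟩ := step2 x (cl_pp hT hx t0 n1 n2) (cl_pp hT hx t1 n3 n4)
  have so' : SameOrbit T (T.image g) := ⟨g, hg, rfl⟩
  refine ⟨_, so_trans so so', clique_so so' hT, ?_, ?_, gx ▸ Finset.mem_image_of_mem g hx⟩
  · have := Finset.mem_image_of_mem g t0
    rwa [g0] at this
  · have := Finset.mem_image_of_mem g t1
    rwa [g1] at this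

theorem norm3 (S : Finset Exc) (hS : Clique13 S) :
    ∃ T, SameOrbit S T ∧ Clique13 T ∧ r 0 ∈ T ∧ r 1 ∈ T ∧ r 2 ∈ T ∧ r 4 ∈ T := by
  obtain ⟨T, so, hT, t0, t1, t2⟩ := norm2 S hS
  obtain ⟨x, hx, hn⟩ := pick hT ({r 0, ng (r 0), r 1, ng (r 1)} ∪ {r 2, ng (r 2), r 3, ng (r 3)})
    ((Finset.card_union_le _ _).trans
      ((add_le_add Finset.card_le_four Finset.card_le_four).trans (by norm_num)))
  simp only [Finset.mem_union, Finset.mem_insert, Finset.mem_singleton, not_or] at hn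
  obtain ⟨⟨n1, n2, n3, n4⟩, n5, n6, n7, n8⟩ := hn
  obtain ⟨g, hg, gx, g0, g1, g2⟩ := step3 x (cl_pp hT hx t0 n1 n2) (cl_pp hT hx t1 n3 n4)
    (cl_pp hT hx t2 n5 n6) n7 n8
  have so' : SameOrbit T (T.image g) := ⟨g, hg, rfl⟩
  refine ⟨_, so_trans so so', clique_so so' hT, ?_, ?_, ?_, gx ▸ Finset.mem_image_of_mem g hx⟩
  · have := Finset.mem_image_of_mem g t0
    rwa [g0] at this
  · have := Finset.mem_image_of_mem g t1
    rwa [g1] at this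
  · have := Finset.mem_image_of_mem g t2
    rwa [g2] at this

theorem norm4 (S : Finset Exc) (hS : Clique13 S) :
    ∃ T, SameOrbit S T ∧ Clique13 T ∧ ∀ x ∈ T, ∃ q, R q = x := by
  obtain ⟨T, so, hT, t0, t1, t2, t4⟩ := norm3 S hS
  refine ⟨T, so, hT, fun x hx => ?_⟩
  by_contra hc
  have key : ∀ i, r i ∈ T → pp x (r i) = 0 := fun i hi => cl_pp hT hx hi
    (fun e => hc ⟨(i, false), e.symm⟩) (fun e => hc ⟨(i, true), e.symm⟩)
  exact hc (in_frame x (key 0 t0) (key 1 t1) (key 2 t2) (key 4 t4))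

theorem R_inj : Function.Injective R := by
  have : ∀ p q, R p = R q → p = q := by decide +kernel
  exact fun p q => this p q

/-- The frame subset with `t i` elements on the `i`-th line. -/
def Cset (t : Fin 8 → Fin 3) : Finset Exc :=
  (Finset.univ.filter (fun q : Fin 8 × Bool => q.2.toNat < (t q.1 : ℕ))).image R

theorem mem_Cset (t : Fin 8 → Fin 3) (q : Fin 8 × Bool) :
    R q ∈ Cset t ↔ q.2.toNat < (t q.1 : ℕ) := by
  simp [Cset, R_inj.eq_iff]

theorem card_Cset (t : Fin 8 → Fin 3) : (Cset t).card = ∑ i, (t i : ℕ) := by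
  rw [Cset, Finset.card_image_of_injective _ R_inj, Finset.card_filter, Fintype.sum_prod_type]
  refine Finset.sum_congr rfl fun i _ => ?_
  have : ∀ a : Fin 3, (∑ y : Bool, if y.toNat < (a : ℕ) then 1 else 0) = (a : ℕ) := by decide
  exact this (t i)

theorem pp_inv {g : Exc ≃ Exc} (hg : PreservesB g) (x y : Exc) : pp (g x) (g y) = pp x y :=
  (pres_iff g).1 hg x y

theorem g_ng {g : Exc ≃ Exc} (hg : PreservesB g) (x : Exc) : g (ng x) = ng (g x) := by
  apply eq_ng
  rw [pp_inv hg, pp_ng, pp_self]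

theorem signs (D : Finset (Fin 8)) : ∃ g : Exc ≃ Exc, PreservesB g ∧
    ∀ i, g (r i) = if i ∈ D then ng (r i) else r i := by
  induction D using Finset.induction_on with
  | empty => exact ⟨Equiv.refl _, pres_refl, by simp⟩
  | insert a D ha ih =>
    obtain ⟨g, hg, h⟩ := ih
    refine ⟨(reflE (r a)).trans g, pres_trans (pres_reflE _) hg, fun i => ?_⟩
    simp only [Equiv.trans_apply, reflE_apply, Finset.mem_insert]
    by_cases e : i = a
    · subst e
      have := h i
      rw [if_neg ha] at this
      simp only [true_or, if_true]
      change g (ng (r i)) = _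
      rw [g_ng hg, this]
    · rw [refl_fix _ _ (r_orth _ _ e), h]
      simp [e]

theorem norm5 (S : Finset Exc) (hS : Clique13 S) :
    ∃ t, SameOrbit S (Cset t) ∧ ∑ i, (t i : ℕ) = 10 := by
  obtain ⟨T, so, hT, hR⟩ := norm4 S hS
  let t : Fin 8 → Fin 3 := fun i =>
    (if R (i, false) ∈ T then 1 else 0) + (if R (i, true) ∈ T then 1 else 0)
  obtain ⟨g, hg, hr⟩ := signs (Finset.univ.filter fun i => R (i, false) ∉ T)
  have hgR : ∀ i b, g (R (i, b)) = if R (i, false) ∈ T then R (i, b) else R (i, !b) := by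
    intro i b
    have h1 : g (r i) = if R (i, false) ∈ T then r i else ng (r i) := by
      rw [hr]; by_cases h : R (i, false) ∈ T <;> simp [h]
    cases b
    · change g (r i) = _
      rw [h1]; rfl
    · change g (ng (r i)) = _
      rw [g_ng hg, h1]
      by_cases h : R (i, false) ∈ T
      · rw [if_pos h, if_pos h]; rfl
      · rw [if_neg h, if_neg h, ng_ng]; rfl
  have so' : SameOrbit T (Cset t) := by
    refine ⟨g, hg, ?_⟩
    have key : ∀ i b, R (i, b) ∈ T.image g ↔ R (i, b) ∈ Cset t := by
      intro i b
      rw [mem_Cset]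
      by_cases h : R (i, false) ∈ T
      · have e : R (i, b) = g (R (i, b)) := by rw [hgR, if_pos h]
        rw [e, g.injective.mem_finset_image] 
        cases b
        · by_cases h' : R (i, true) ∈ T <;> simp [h, h', t]
        · by_cases h' : R (i, true) ∈ T <;> simp [h, h', t]
      · have e : R (i, b) = g (R (i, !b)) := by rw [hgR, if_neg h, Bool.not_not]
        rw [e, g.injective.mem_finset_image]
        cases b
        · by_cases h' : R (i, true) ∈ T <;> simp [h, h', t]
        · by_cases h' : R (i, true) ∈ T <;> simp [h, h', t]
    ext x
    constructor
    · intro hx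
      obtain ⟨a, ha, rfl⟩ := Finset.mem_image.1 hx
      obtain ⟨⟨i, b⟩, rfl⟩ := hR a ha
      rw [hgR] at hx ⊢
      split_ifs at hx ⊢ <;> exact (key _ _).1 hx
    · intro hx
      obtain ⟨⟨i, b⟩, -, rfl⟩ := Finset.mem_image.1 hx
      exact (key i b).2 hx
  refine ⟨t, so_trans so so', ?_⟩
  rw [← card_Cset]
  exact (clique_so so' hT).1

/-! Permutations of the frame. -/

def G : Fin 6 → Fin 8 → Fin 8 := ![
  ![0, 2, 1, 3, 4, 6, 5, 7],
  ![0, 1, 2, 3, 5, 4, 7, 6],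
  ![1, 0, 2, 3, 4, 5, 7, 6],
  ![0, 1, 2, 3, 6, 7, 4, 5],
  ![0, 1, 3, 2, 4, 5, 7, 6],
  ![0, 1, 4, 5, 2, 3, 6, 7]]

def Av : Fin 6 → Fin 9 → ℤ := ![
  ![3, 1, 2, 0, 1, 1, 1, 1, 1],
  ![2, 1, 0, 1, 1, 0, 1, 0, 1],
  ![3, 2, 0, 1, 1, 1, 1, 1, 1],
  ![2, 1, 1, 0, 1, 0, 0, 1, 1],
  ![2, 1, 0, 1, 1, 1, 0, 0, 1],
  ![3, 1, 1, 2, 0, 1, 1, 1, 1]]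
theorem Ae : ∀ i, IsExc (Av i) := by decide +kernel
def A1 (i : Fin 6) : Exc := ⟨Av i, Ae i⟩

def Bv : Fin 6 → Fin 9 → ℤ := ![
  ![3, 1, 1, 1, 1, 1, 2, 0, 1],
  ![2, 0, 1, 1, 1, 0, 1, 1, 0],
  ![3, 1, 1, 1, 1, 1, 1, 2, 0],
  ![2, 0, 1, 1, 1, 0, 1, 1, 0],
  ![2, 0, 1, 1, 1, 1, 0, 1, 0],
  ![3, 1, 1, 1, 1, 2, 0, 1, 1]]
theorem Be : ∀ i, IsExc (Bv i) := by decide +kernel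
def A2 (i : Fin 6) : Exc := ⟨Bv i, Be i⟩

theorem G_act : ∀ k i, rfx (A2 k) (rfx (A1 k) (r i)) = r (G k i) := by decide +kernel
theorem G_inv : ∀ k i, G k (G k i) = i := by decide +kernel

theorem perm (k : Fin 6) (t : Fin 8 → Fin 3) : SameOrbit (Cset t) (Cset (t ∘ G k)) := by
  let g := (reflE (A1 k)).trans (reflE (A2 k))
  have hg : PreservesB g := pres_trans (pres_reflE _) (pres_reflE _)
  have h1 : ∀ i, g (r i) = r (G k i) := G_act k
  have h2 : ∀ i b, g (R (i, b)) = R (G k i, b) := by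
    intro i b
    cases b
    · exact h1 i
    · change g (ng (r i)) = ng (r _)
      rw [g_ng hg, h1]
  refine ⟨g, hg, ?_⟩
  ext x
  constructor
  · intro hx
    obtain ⟨a, ha, rfl⟩ := Finset.mem_image.1 hx
    obtain ⟨⟨i, b⟩, -, rfl⟩ := Finset.mem_image.1 ha
    rw [h2, mem_Cset]
    rw [mem_Cset] at ha
    simpa [G_inv] using ha
  · intro hx
    obtain ⟨⟨i, b⟩, -, rfl⟩ := Finset.mem_image.1 hx
    rw [mem_Cset] at hx
    have : R (i, b) = g (R (G k i, b)) := by rw [h2, G_inv]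
    rw [this, g.injective.mem_finset_image, mem_Cset]
    simpa using hx

def code (t : Fin 8 → Fin 3) : ℕ :=
  (t 0 : ℕ) * 2187 + t 1 * 729 + t 2 * 243 + t 3 * 81 + t 4 * 27 + t 5 * 9 + t 6 * 3 + t 7

def canon : List (Fin 8 → Fin 3) := [
  ![1, 1, 1, 1, 1, 1, 2, 2],
  ![0, 1, 1, 2, 1, 2, 2, 1],
  ![0, 1, 1, 1, 1, 2, 2, 2],
  ![0, 0, 1, 1, 2, 2, 2, 2],
  ![0, 0, 1, 2, 1, 2, 2, 2],
  ![0, 0, 0, 2, 2, 2, 2, 2]]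

def c8 (a b c d e f g h : Fin 3) : ℕ :=
  (a : ℕ) * 2187 + b * 729 + c * 243 + d * 81 + e * 27 + f * 9 + g * 3 + h

theorem descent1 : ∀ a b c d e f g h : Fin 3,
    (a : ℕ) + b + c + d + e + f + g + h = 10 →
    c8 a c b d e g f h < c8 a b c d e f g h ∨
    c8 a b c d f e h g < c8 a b c d e f g h ∨
    c8 b a c d e f h g < c8 a b c d e f g h ∨
    c8 a b c d g h e f < c8 a b c d e f g h ∨
    c8 a b d c e f h g < c8 a b c d e f g h ∨
    c8 a b e f c d g h < c8 a b c d e f g h ∨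
    c8 a b c d e f g h = 3284 ∨ c8 a b c d e f g h = 1186 ∨ c8 a b c d e f g h = 1106 ∨ c8 a b c d e f g h = 404 ∨ c8 a b c d e f g h = 458 ∨ c8 a b c d e f g h = 242 := by
  decide +kernel

theorem descent0 (a b c d e f g h : Fin 3) (hs : (a : ℕ) + b + c + d + e + f + g + h = 10) :
    code ![a, b, c, d, e, f, g, h] ∈ canon.map code ∨
    ∃ k, code (![a, b, c, d, e, f, g, h] ∘ G k) < code ![a, b, c, d, e, f, g, h] := by
  have hm : canon.map code = [3284, 1186, 1106, 404, 458, 242] := by decide +kernel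
  have hc : code ![a, b, c, d, e, f, g, h] = c8 a b c d e f g h := rfl
  rw [hm, hc]
  rcases descent1 a b c d e f g h hs with k | k | k | k | k | k | k | k | k | k | k | k
  · exact Or.inr ⟨0, k⟩
  · exact Or.inr ⟨1, k⟩
  · exact Or.inr ⟨2, k⟩
  · exact Or.inr ⟨3, k⟩
  · exact Or.inr ⟨4, k⟩
  · exact Or.inr ⟨5, k⟩
  · rw [k]; exact Or.inl (by decide)
  · rw [k]; exact Or.inl (by decide)
  · rw [k]; exact Or.inl (by decide)
  · rw [k]; exact Or.inl (by decide)
  · rw [k]; exact Or.inl (by decide)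
  · rw [k]; exact Or.inl (by decide)

theorem code_inj (t u : Fin 8 → Fin 3) (h : code t = code u) : t = u := by
  simp only [code] at h
  funext i
  apply Fin.ext
  fin_cases i <;> simp <;> omega

theorem reduce (n : ℕ) : ∀ t : Fin 8 → Fin 3, code t = n → ∑ i, (t i : ℕ) = 10 →
    ∃ u ∈ canon, SameOrbit (Cset t) (Cset u) := by
  induction n using Nat.strong_induction_on with
  | _ n ih =>
    intro t hc hs
    have ht : ![t 0, t 1, t 2, t 3, t 4, t 5, t 6, t 7] = t := by
      funext i; fin_cases i <;> rfl
    have hs' := hs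
    rw [Fin.sum_univ_eight] at hs'
    have := descent0 _ _ _ _ _ _ _ _ hs'
    rw [ht] at this
    rcases this with h | ⟨k, hk⟩
    · obtain ⟨u, hu, e⟩ := List.mem_map.1 h
      rw [← code_inj _ _ e]
      exact ⟨u, hu, so_refl _⟩
    · have so := perm k t
      have hs2 : ∑ i, ((t ∘ G k) i : ℕ) = 10 := by
        rw [← card_Cset]
        obtain ⟨g, hg, e⟩ := so
        rw [← e, Finset.card_image_of_injective _ g.injective, card_Cset, hs]
      obtain ⟨u, hu, so'⟩ := ih _ (hc ▸ hk) _ rfl hs2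
      exact ⟨u, hu, so_trans so so'⟩

theorem main (S : Finset Exc) (hS : Clique13 S) : ∃ u ∈ canon, SameOrbit S (Cset u) := by
  obtain ⟨t, so, hs⟩ := norm5 S hS
  obtain ⟨u, hu, so'⟩ := reduce _ t rfl hs
  exact ⟨u, hu, so_trans so so'⟩

theorem R_pair : ∀ p q, p ≠ q → Bx (R p) (R q) = 1 ∨ Bx (R p) (R q) = 3 := by decide +kernel

theorem cl_canon : ∀ u ∈ canon, Clique13 (Cset u) := by
  intro u hu
  have h : ∑ i, (u i : ℕ) = 10 := by
    simp only [canon, List.mem_cons, List.not_mem_nil, or_false] at hu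
    rcases hu with rfl | rfl | rfl | rfl | rfl | rfl <;> decide +kernel
  refine ⟨by rw [card_Cset, h], fun x hx y hy hxy => ?_⟩
  obtain ⟨p, -, rfl⟩ := Finset.mem_image.1 hx
  obtain ⟨q, -, rfl⟩ := Finset.mem_image.1 hy
  exact R_pair p q (fun e => hxy (by rw [e]))

theorem n1 : nPairs3 (Cset ![1, 1, 1, 1, 1, 1, 2, 2]) = 2 := by decide +kernel
theorem n2 : nPairs3 (Cset ![0, 1, 1, 2, 1, 2, 2, 1]) = 3 := by decide +kernel
theorem n3 : nPairs3 (Cset ![0, 1, 1, 1, 1, 2, 2, 2]) = 3 := by decide +kernel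
theorem n4 : nPairs3 (Cset ![0, 0, 1, 1, 2, 2, 2, 2]) = 4 := by decide +kernel
theorem n5 : nPairs3 (Cset ![0, 0, 1, 2, 1, 2, 2, 2]) = 4 := by decide +kernel
theorem n6 : nPairs3 (Cset ![0, 0, 0, 2, 2, 2, 2, 2]) = 5 := by decide +kernel

/-! Distinguishing orbits. -/

def Inv3 (S : Finset Exc) : Prop :=
  ∃ x, ∀ y ∈ S, (∀ z ∈ S, Bx y z ≠ 3) → Bx x y % 2 = 0

def Inv4 (S : Finset Exc) : Prop :=
  ∃ x, ∀ y ∈ S, (∃ z ∈ S, Bx y z = 3) → Bx x y % 2 = 0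

theorem inv3_so {S T : Finset Exc} (h : SameOrbit S T) (hS : Inv3 S) : Inv3 T := by
  obtain ⟨g, hg, rfl⟩ := h
  obtain ⟨x, hx⟩ := hS
  refine ⟨g x, fun y hy hz => ?_⟩
  obtain ⟨a, ha, rfl⟩ := Finset.mem_image.1 hy
  rw [hg]
  refine hx a ha fun z hzS => ?_
  rw [← hg]
  exact hz _ (Finset.mem_image_of_mem g hzS)

theorem inv4_so {S T : Finset Exc} (h : SameOrbit S T) (hS : Inv4 S) : Inv4 T := by
  obtain ⟨g, hg, rfl⟩ := h
  obtain ⟨x, hx⟩ := hS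
  refine ⟨g x, fun y hy hz => ?_⟩
  obtain ⟨a, ha, rfl⟩ := Finset.mem_image.1 hy
  obtain ⟨z, hz, e⟩ := hz
  obtain ⟨b, hb, rfl⟩ := Finset.mem_image.1 hz
  rw [hg] at e ⊢
  exact hx a ha ⟨b, hb, e⟩

/-- half of `r 1 + r 2 + r 4 + r 7` -/
def w3 : Exc := ⟨![4, 1, 2, 2, 2, 1, 1, 1, 1], by decide +kernel⟩
/-- half of `r 4 + r 5 + r 6 + r 7` -/
def w4 : Exc := ⟨![6, 2, 2, 2, 3, 2, 2, 2, 2], by decide +kernel⟩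

theorem inv3_yes : Inv3 (Cset ![0, 1, 1, 2, 1, 2, 2, 1]) := by
  refine ⟨w3, ?_⟩
  decide +kernel

theorem inv4_yes : Inv4 (Cset ![0, 0, 1, 1, 2, 2, 2, 2]) := by
  refine ⟨w4, ?_⟩
  decide +kernel

theorem odd_sq {a : ℤ} (h : a % 2 = 1) : 1 ≤ a ^ 2 := by
  have : a ≠ 0 := by rintro rfl; simp at h
  have := pow_pos (abs_pos.2 this) 2
  rw [sq_abs] at this
  exact this

theorem inv3_no : ¬ Inv3 (Cset ![0, 1, 1, 1, 1, 2, 2, 2]) := by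
  rintro ⟨x, hx⟩
  have key : ∀ i ∈ ({1, 2, 3, 4} : Finset (Fin 8)),
      r i ∈ Cset ![0, 1, 1, 1, 1, 2, 2, 2] ∧
      ∀ z ∈ Cset ![0, 1, 1, 1, 1, 2, 2, 2], Bx (r i) z ≠ 3 := by decide +kernel
  have k : ∀ i ∈ ({1, 2, 3, 4} : Finset (Fin 8)), pp x (r i) % 2 = 1 := by
    intro i hi
    have := hx _ (key i hi).1 (key i hi).2
    rw [pp]; omega
  have k1 := k 1 (by decide)
  have k2 := k 2 (by decide)
  have k3 := k 3 (by decide)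
  have k4 := k 4 (by decide)
  have k0 : pp x (r 0) % 2 = 1 := by
    have := K_lin x
    rw [y1] at k1
    rw [y2] at k2
    rw [y3] at k3
    rw [y0]
    omega
  have s := sq_sum x
  rw [Fin.sum_univ_eight] at s
  linarith [odd_sq k0, odd_sq k1, odd_sq k2, odd_sq k3, odd_sq k4, sq_nonneg (pp x (r 5)),
    sq_nonneg (pp x (r 6)), sq_nonneg (pp x (r 7))]

theorem inv4_no : ¬ Inv4 (Cset ![0, 0, 1, 2, 1, 2, 2, 2]) := by
  rintro ⟨x, hx⟩
  have key : ∀ i ∈ ({3, 5, 6, 7} : Finset (Fin 8)),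
      r i ∈ Cset ![0, 0, 1, 2, 1, 2, 2, 2] ∧
      ∃ z ∈ Cset ![0, 0, 1, 2, 1, 2, 2, 2], Bx (r i) z = 3 := by decide +kernel
  have k : ∀ i ∈ ({3, 5, 6, 7} : Finset (Fin 8)), pp x (r i) % 2 = 1 := by
    intro i hi
    have := hx _ (key i hi).1 (key i hi).2
    rw [pp]; omega
  have k3 := k 3 (by decide)
  have k5 := k 5 (by decide)
  have k6 := k 6 (by decide)
  have k7 := k 7 (by decide)
  have k4 : pp x (r 4) % 2 = 1 := by
    have := K_lin x
    rw [y5] at k5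
    rw [y6] at k6
    rw [y7] at k7
    rw [y4]
    omega
  have s := sq_sum x
  rw [Fin.sum_univ_eight] at s
  linarith [odd_sq k3, odd_sq k4, odd_sq k5, odd_sq k6, odd_sq k7, sq_nonneg (pp x (r 0)),
    sq_nonneg (pp x (r 1)), sq_nonneg (pp x (r 2))]

theorem main' (S : Finset Exc) (hS : Clique13 S) :
    (nPairs3 S = 2 ∧ SameOrbit S (Cset ![1, 1, 1, 1, 1, 1, 2, 2])) ∨
    (nPairs3 S = 3 ∧ (SameOrbit S (Cset ![0, 1, 1, 2, 1, 2, 2, 1]) ∨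
      SameOrbit S (Cset ![0, 1, 1, 1, 1, 2, 2, 2]))) ∨
    (nPairs3 S = 4 ∧ (SameOrbit S (Cset ![0, 0, 1, 1, 2, 2, 2, 2]) ∨
      SameOrbit S (Cset ![0, 0, 1, 2, 1, 2, 2, 2]))) ∨
    (nPairs3 S = 5 ∧ SameOrbit S (Cset ![0, 0, 0, 2, 2, 2, 2, 2])) := by
  obtain ⟨u, hu, so⟩ := main S hS
  have hn := nP_so so
  simp only [canon, List.mem_cons, List.not_mem_nil, or_false] at hu
  rcases hu with rfl | rfl | rfl | rfl | rfl | rfl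
  · rw [n1] at hn; exact Or.inl ⟨hn, so⟩
  · rw [n2] at hn; exact Or.inr (Or.inl ⟨hn, Or.inl so⟩)
  · rw [n3] at hn; exact Or.inr (Or.inl ⟨hn, Or.inr so⟩)
  · rw [n4] at hn; exact Or.inr (Or.inr (Or.inl ⟨hn, Or.inl so⟩))
  · rw [n5] at hn; exact Or.inr (Or.inr (Or.inl ⟨hn, Or.inr so⟩))
  · rw [n6] at hn; exact Or.inr (Or.inr (Or.inr ⟨hn, so⟩))

/-- For 10-element cliques `S` with weights in `{1,3}`, the number `n(S)` of pairs pairing to 3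
lies in `{2,3,4,5}`; those with `n(S) = 2` form a single `W`-orbit, those with `n(S) = 3` form
exactly two `W`-orbits, those with `n(S) = 4` form exactly two `W`-orbits, and those with
`n(S) = 5` form a single `W`-orbit. -/
theorem stmt9 :
    (∀ S : Finset Exc, Clique13 S → nPairs3 S ∈ ({2, 3, 4, 5} : Set ℕ)) ∧
    ((∃ S : Finset Exc, Clique13 S ∧ nPairs3 S = 2) ∧
      ∀ S T : Finset Exc, Clique13 S → Clique13 T → nPairs3 S = 2 → nPairs3 T = 2 →
        SameOrbit S T) ∧
    (∃ S T : Finset Exc, Clique13 S ∧ Clique13 T ∧ nPairs3 S = 3 ∧ nPairs3 T = 3 ∧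
      ¬ SameOrbit S T ∧
      ∀ U : Finset Exc, Clique13 U → nPairs3 U = 3 → SameOrbit U S ∨ SameOrbit U T) ∧
    (∃ S T : Finset Exc, Clique13 S ∧ Clique13 T ∧ nPairs3 S = 4 ∧ nPairs3 T = 4 ∧
      ¬ SameOrbit S T ∧
      ∀ U : Finset Exc, Clique13 U → nPairs3 U = 4 → SameOrbit U S ∨ SameOrbit U T) ∧
    ((∃ S : Finset Exc, Clique13 S ∧ nPairs3 S = 5) ∧
      ∀ S T : Finset Exc, Clique13 S → Clique13 T → nPairs3 S = 5 → nPairs3 T = 5 →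
        SameOrbit S T) := by
  have c1 := cl_canon ![1, 1, 1, 1, 1, 1, 2, 2] (by simp [canon])
  have c2 := cl_canon ![0, 1, 1, 2, 1, 2, 2, 1] (by simp [canon])
  have c3 := cl_canon ![0, 1, 1, 1, 1, 2, 2, 2] (by simp [canon])
  have c4 := cl_canon ![0, 0, 1, 1, 2, 2, 2, 2] (by simp [canon])
  have c5 := cl_canon ![0, 0, 1, 2, 1, 2, 2, 2] (by simp [canon])
  have c6 := cl_canon ![0, 0, 0, 2, 2, 2, 2, 2] (by simp [canon])
  refine ⟨?_, ⟨⟨_, c1, n1⟩, ?_⟩, ⟨_, _, c2, c3, n2, n3, ?_, ?_⟩, ⟨_, _, c4, c5, n4, n5, ?_, ?_⟩,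
    ⟨⟨_, c6, n6⟩, ?_⟩⟩
  · intro S hS
    simp only [Set.mem_insert_iff, Set.mem_singleton_iff]
    have := main' S hS
    tauto
  · intro S T hS hT h1 h2
    have a : SameOrbit S (Cset ![1, 1, 1, 1, 1, 1, 2, 2]) := by
      have := main' S hS; rw [h1] at this; simpa using this
    have b : SameOrbit T (Cset ![1, 1, 1, 1, 1, 1, 2, 2]) := by
      have := main' T hT; rw [h2] at this; simpa using this
    exact so_trans a (so_symm b)
  · exact fun h => inv3_no (inv3_so h inv3_yes)
  · intro U hU h
    have := main' U hU; rw [h] at this; simpa using this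
  · exact fun h => inv4_no (inv4_so h inv4_yes)
  · intro U hU h
    have := main' U hU; rw [h] at this; simpa using this
  · intro S T hS hT h1 h2
    have a : SameOrbit S (Cset ![0, 0, 0, 2, 2, 2, 2, 2]) := by
      have := main' S hS; rw [h1] at this; simpa using this
    have b : SameOrbit T (Cset ![0, 0, 0, 2, 2, 2, 2, 2]) := by
      have := main' T hT; rw [h2] at this; simpa using this
    exact so_trans a (so_symm b)
end

section
/- Let S be the set of ten vectors {(1,0,0,0,0,0,0,1,1), (1,0,0,1,1,0,0,0,0), (1,1,1,0,0,0,0,0,0), (1,0,0,0,0,1,1,0,0), (4,2,1,2,1,2,1,1,1), (4,1,2,2,1,1,1,1,2), (4,1,1,2,1,1,2,2,1), (4,1,2,1,2,1,2,1,1), (4,2,1,1,2,1,1,2,1), (4,2,1,1,1,1,2,1,2)} in Z^9. Then each element of S is an exceptional class, S is a 10-element clique with weights in {1,2}, and there is no exceptional class c in C such that B(c, s) = 0 for four distinct elements s of S. -/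
/-- The set `S` of ten vectors from Proposition `prop: dP2's` of the paper. -/
def Sv : Finset (Fin 9 → ℤ) :=
  { ![1, 0, 0, 0, 0, 0, 0, 1, 1], ![1, 0, 0, 1, 1, 0, 0, 0, 0],
    ![1, 1, 1, 0, 0, 0, 0, 0, 0], ![1, 0, 0, 0, 0, 1, 1, 0, 0],
    ![4, 2, 1, 2, 1, 2, 1, 1, 1], ![4, 1, 2, 2, 1, 1, 1, 1, 2],
    ![4, 1, 1, 2, 1, 1, 2, 2, 1], ![4, 1, 2, 1, 2, 1, 2, 1, 1],
    ![4, 2, 1, 1, 2, 1, 1, 2, 1], ![4, 2, 1, 1, 1, 1, 2, 1, 2] }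

def L12 : List (Fin 9 → ℤ) :=
  [ ![1, 0, 0, 0, 0, 0, 0, 1, 1], ![1, 0, 0, 1, 1, 0, 0, 0, 0],
    ![1, 1, 1, 0, 0, 0, 0, 0, 0], ![1, 0, 0, 0, 0, 1, 1, 0, 0],
    ![4, 2, 1, 2, 1, 2, 1, 1, 1], ![4, 1, 2, 2, 1, 1, 1, 1, 2],
    ![4, 1, 1, 2, 1, 1, 2, 2, 1], ![4, 1, 2, 1, 2, 1, 2, 1, 1],
    ![4, 2, 1, 1, 2, 1, 1, 2, 1], ![4, 2, 1, 1, 1, 1, 2, 1, 2] ]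

def B12 (v w : Fin 9 → ℤ) : ℤ :=
  v 0 * w 0 - (v 1 * w 1 + v 2 * w 2 + v 3 * w 3 + v 4 * w 4 + v 5 * w 5 + v 6 * w 6
    + v 7 * w 7 + v 8 * w 8)

theorem B_eq (v w : Fin 9 → ℤ) : B v w = B12 v w := by
  simp only [B, B12, Fin.sum_univ_eight]; rfl

def tst (a : ℤ) (l : List ℤ) : Bool :=
  decide ((L12.filter (fun s => decide (B12 (fun i => (a :: l).getD i.val 0) s = 0))).length ≤ 3)

def okp (n s q : ℤ) : Bool :=
  decide (0 ≤ q + s) && decide (0 ≤ q - s) && decide (0 ≤ q - 3 * s + 2 * n)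
    && decide (0 ≤ q - 5 * s + 6 * n)

def xs12 : List ℤ := [-7, -6, -5, -4, -3, -2, -1, 0, 1, 2, 3, 4, 5, 6, 7]

def chk : ℕ → ℤ → ℤ → (List ℤ → Bool) → Bool
  | 0, s, q, k => !(decide (s = 0) && decide (q = 0)) || k []
  | n + 1, s, q, k => !(okp ((n : ℤ) + 1) s q) ||
      xs12.all (fun x => chk n (s - x) (q - x * x) (fun l => k (x :: l)))

theorem int_aux (x t : ℤ) : 0 ≤ (x - t) * (x - t - 1) := by
  rcases le_or_gt x t with h | h
  · exact mul_nonneg_of_nonpos_of_nonpos (by omega) (by omega)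
  · exact mul_nonneg (by omega) (by omega)

theorem okp_list (l : List ℤ) : okp l.length l.sum (l.map (fun x => x * x)).sum = true := by
  simp only [okp, Bool.and_eq_true, decide_eq_true_eq]
  induction l with
  | nil => simp
  | cons x l ih =>
    obtain ⟨⟨⟨h1, h2⟩, h3⟩, h4⟩ := ih
    have a1 := int_aux x (-1)
    have a2 := int_aux x 0
    have a3 := int_aux x 1
    have a4 := int_aux x 2
    simp only [List.length_cons, List.sum_cons, List.map_cons]
    push_cast
    refine ⟨⟨⟨?_, ?_⟩, ?_⟩, ?_⟩ <;> nlinarith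

theorem sq_nonneg_list (l : List ℤ) : 0 ≤ (l.map (fun x => x * x)).sum := by
  induction l with
  | nil => simp
  | cons x l ih => simp only [List.sum_cons, List.map_cons]; nlinarith [mul_self_nonneg x]

theorem chk_sound (l : List ℤ) : ∀ (k : List ℤ → Bool),
    (l.map (fun x => x * x)).sum ≤ 50 →
    chk l.length l.sum (l.map (fun x => x * x)).sum k = true → k l = true := by
  induction l with
  | nil => intro k _ h; simpa [chk] using h
  | cons x l ih =>
    intro k hq h
    have ho := okp_list (x :: l)
    have hn := sq_nonneg_list l
    rw [List.length_cons] at h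
    rw [List.length_cons, Nat.cast_add, Nat.cast_one] at ho
    rw [chk, ho] at h
    simp only [List.sum_cons, List.map_cons] at h hq
    simp only [Bool.not_true, Bool.false_or, List.all_eq_true] at h
    have hx1 : x ≤ 7 := by nlinarith
    have hx2 : -7 ≤ x := by nlinarith
    have hx : x ∈ xs12 := by
      simp only [xs12, List.mem_cons, List.not_mem_nil, or_false]; omega
    have h' := h x hx
    rw [add_sub_cancel_left, add_sub_cancel_left] at h'
    exact ih (fun l => k (x :: l)) (by nlinarith [mul_self_nonneg x]) h'

theorem chk_all : ([-1, 0, 1, 2, 3, 4, 5, 6, 7] : List ℤ).all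
    (fun a => chk 8 (3 * a - 1) (a * a + 1) (tst a)) = true := by
  decide +kernel

theorem exc_tst (c : Fin 9 → ℤ) (hc : IsExc c) :
    (L12.filter (fun s => decide (B12 c s = 0))).length ≤ 3 := by
  obtain ⟨h1, h2⟩ := hc
  rw [B_eq] at h1 h2
  have h2' : c 1 + c 2 + c 3 + c 4 + c 5 + c 6 + c 7 + c 8 = 3 * c 0 - 1 := by
    simp [B12, Kcl] at h2; linarith
  have h1' : c 1 * c 1 + c 2 * c 2 + c 3 * c 3 + c 4 * c 4 + c 5 * c 5 + c 6 * c 6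
      + c 7 * c 7 + c 8 * c 8 = c 0 * c 0 + 1 := by
    simp only [B12] at h1; linarith
  have hcs : (3 * c 0 - 1) * (3 * c 0 - 1) ≤ 8 * (c 0 * c 0 + 1) := by
    rw [← h1']
    have e : ∀ s : ℤ, c 1 + c 2 + c 3 + c 4 + c 5 + c 6 + c 7 + c 8 = s →
      64 * (8 * (c 1 * c 1 + c 2 * c 2 + c 3 * c 3 + c 4 * c 4 + c 5 * c 5 + c 6 * c 6
      + c 7 * c 7 + c 8 * c 8) - s * s) = 8 * ((8 * c 1 - s)^2 + (8 * c 2 - s)^2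
      + (8 * c 3 - s)^2 + (8 * c 4 - s)^2 + (8 * c 5 - s)^2 + (8 * c 6 - s)^2
      + (8 * c 7 - s)^2 + (8 * c 8 - s)^2) := by
      rintro s rfl; ring
    have e' := e _ h2'
    have : 0 ≤ (8 * c 1 - (3 * c 0 - 1))^2 + (8 * c 2 - (3 * c 0 - 1))^2
      + (8 * c 3 - (3 * c 0 - 1))^2 + (8 * c 4 - (3 * c 0 - 1))^2 + (8 * c 5 - (3 * c 0 - 1))^2
      + (8 * c 6 - (3 * c 0 - 1))^2
      + (8 * c 7 - (3 * c 0 - 1))^2 + (8 * c 8 - (3 * c 0 - 1))^2 := by positivity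
    linarith
  have ha1 : c 0 ≤ 7 := by nlinarith
  have ha2 : -1 ≤ c 0 := by nlinarith
  have hall := List.all_eq_true.1 chk_all (c 0) (by
    simp only [List.mem_cons, List.not_mem_nil, or_false]; omega)
  have key := chk_sound [c 1, c 2, c 3, c 4, c 5, c 6, c 7, c 8] (tst (c 0))
  have es : [c 1, c 2, c 3, c 4, c 5, c 6, c 7, c 8].sum = 3 * c 0 - 1 := by
    simp only [List.sum_cons, List.sum_nil]; linarith
  have eq : ([c 1, c 2, c 3, c 4, c 5, c 6, c 7, c 8].map (fun x => x * x)).sum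
      = c 0 * c 0 + 1 := by
    simp only [List.map_cons, List.map_nil, List.sum_cons, List.sum_nil]; linarith
  rw [es, eq] at key
  have := key (by nlinarith) hall
  have h := of_decide_eq_true this
  have hf : (fun i : Fin 9 => (c 0 :: [c 1, c 2, c 3, c 4, c 5, c 6, c 7, c 8]).getD i.val 0)
      = c := by
    funext i; fin_cases i <;> rfl
  rw [hf] at h
  exact h

theorem Sv_eq : Sv = L12.toFinset := by
  ext x; simp [Sv, L12]

theorem stmt12 :
    (∀ v ∈ Sv, IsExc v) ∧ Sv.card = 10 ∧
    (∀ x ∈ Sv, ∀ y ∈ Sv, x ≠ y → B x y ∈ ({1, 2} : Set ℤ)) ∧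
    ¬ ∃ c : Fin 9 → ℤ, IsExc c ∧ ∃ T ⊆ Sv, T.card = 4 ∧ ∀ s ∈ T, B c s = 0 := by
  refine ⟨?_, by decide +kernel, ?_, ?_⟩
  · have h : ∀ v ∈ Sv, B v v = -1 ∧ B v Kcl = -1 := by decide +kernel
    exact h
  · have h : ∀ x ∈ Sv, ∀ y ∈ Sv, x ≠ y → B x y = 1 ∨ B x y = 2 := by decide +kernel
    exact h
  · rintro ⟨c, hc, T, hT, h4, h0⟩
    have h3 := exc_tst c hc
    have hs : T ⊆ (L12.filter (fun s => decide (B12 c s = 0))).toFinset := by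
      intro s hs
      have hm := hT hs
      rw [Sv_eq, List.mem_toFinset] at hm
      rw [List.mem_toFinset, List.mem_filter]
      exact ⟨hm, decide_eq_true (by rw [← B_eq]; exact h0 s hs)⟩
    have h5 := (Finset.card_le_card hs).trans (List.toFinset_card_le _)
    omega
end
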